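/- Let M be a nonzero A-module with the equal images property, and let N be a minimal second syzygy of M. If N has the same Jordan type as M, i.e., dim_k N = dim_k M and rank(u_N^j) = rank(u_M^j) for every point operator u and every j ≥ 1, then N does not have the equal images property. -/

import Mathlib

open MvPolynomial Module

set_option maxHeartbeats 1000000
set_option synthInstance.maxHeartbeats 400000

noncomputable section

/-- The defining ideal `(X^p, Y^p)` of the polynomial ring in two variables. -/
def relI (k : Type) [Field k] (p : ℕ) : Ideal (MvPolynomial (Fin 2) k) :=
  Ideal.span {(X 0 : MvPolynomial (Fin 2) k) ^ p, (X 1 : MvPolynomial (Fin 2) k) ^ p}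

/-- The algebra `A = k[X,Y]/(X^p, Y^p)`. -/
abbrev Amod (k : Type) [Field k] (p : ℕ) : Type :=
  MvPolynomial (Fin 2) k ⧸ relI k p

variable (k : Type) [Field k] (p : ℕ)

/-- `x`, the image of `X` in `A`. -/
def xA : Amod k p := Ideal.Quotient.mk (relI k p) (X 0)

/-- `y`, the image of `Y` in `A`. -/
def yA : Amod k p := Ideal.Quotient.mk (relI k p) (X 1)

/-- The maximal ideal `𝔪 = (x, y)` of `A`. -/
def mA : Ideal (Amod k p) := Ideal.span {xA k p, yA k p}

/-- A point operator: `u = α x + β y` with `(α, β) ≠ (0, 0)`. -/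
def IsPointOp (u : Amod k p) : Prop :=
  ∃ α β : k, (α ≠ 0 ∨ β ≠ 0) ∧ u = α • xA k p + β • yA k p

/-- Equal images property: `u M = 𝔪 M` for every point operator `u`. -/
def EIP (M : Type) [AddCommGroup M] [Module (Amod k p) M] : Prop :=
  ∀ u : Amod k p, IsPointOp k p u →
    LinearMap.range (LinearMap.lsmul (Amod k p) M u)
      = mA k p • (⊤ : Submodule (Amod k p) M)

/-- `M` lies in `EIP_d`: equal images property and `𝔪^d M = 0`. -/
def EIPd (d : ℕ) (M : Type) [AddCommGroup M] [Module (Amod k p) M] : Prop :=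
  EIP k p M ∧ (mA k p) ^ d • (⊤ : Submodule (Amod k p) M) = ⊥


/-- `IsMinSyz m N M`: the `A`-module `N` is a minimal `m`-th syzygy of `M`, i.e. it arises
(up to isomorphism) as the last kernel `ker(F_{m−1} → F_{m−2})` of an exact sequence
`F_{m−1} → ⋯ → F_1 → F_0 → M → 0` of finitely generated free `A`-modules `F_i` with
`ker(F_0 → M) ⊆ 𝔪F_0` and `ker(F_i → F_{i−1}) ⊆ 𝔪F_i`; equivalently, it is obtained by
`m`-fold iteration of minimal first syzygies. -/
def IsMinSyz : ℕ → ModuleCat.{0} (Amod k p) → ModuleCat.{0} (Amod k p) → Prop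
  | 0, N, M => Nonempty ((↥N) ≃ₗ[Amod k p] (↥M))
  | (m + 1), N, M => ∃ (r : ℕ) (g : (Fin r → Amod k p) →ₗ[Amod k p] M),
      Function.Surjective g ∧
      LinearMap.ker g ≤ mA k p • (⊤ : Submodule (Amod k p) (Fin r → Amod k p)) ∧
      IsMinSyz m N (ModuleCat.of (Amod k p) (↥(LinearMap.ker g)))

/-- The quotient of `A` by `𝔪²`, as a trivial square-zero extension. -/
def toTSZ (hp : 2 ≤ p) : Amod k p →ₐ[k] TrivSqZeroExt k (Fin 2 → k) :=
  Ideal.Quotient.liftₐ (relI k p)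
    (MvPolynomial.aeval (fun i : Fin 2 => TrivSqZeroExt.inr (Pi.single i (1 : k)))) (by
      intro a ha
      have hle : relI k p ≤ RingHom.ker (MvPolynomial.aeval (R := k)
          (fun i : Fin 2 => (TrivSqZeroExt.inr (Pi.single i (1 : k)) :
            TrivSqZeroExt k (Fin 2 → k)))) := by
        unfold relI
        rw [Ideal.span_le]
        obtain ⟨n, rfl⟩ := Nat.exists_eq_add_of_le hp
        rintro z (rfl | rfl) <;>
        · simp only [SetLike.mem_coe, RingHom.mem_ker, map_pow, MvPolynomial.aeval_X]
          rw [pow_add, pow_two, TrivSqZeroExt.inr_mul_inr, zero_mul]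
      exact hle ha)

lemma toTSZ_x (hp : 2 ≤ p) : toTSZ k p hp (xA k p) = TrivSqZeroExt.inr (Pi.single 0 1) := by
  exact MvPolynomial.aeval_X _ 0

lemma toTSZ_y (hp : 2 ≤ p) : toTSZ k p hp (yA k p) = TrivSqZeroExt.inr (Pi.single 1 1) := by
  exact MvPolynomial.aeval_X _ 1

/-- augmentation -/
def augA (hp : 2 ≤ p) (a : Amod k p) : k := (toTSZ k p hp a).fst

/-- linear coefficients -/
def dA (hp : 2 ≤ p) (i : Fin 2) (a : Amod k p) : k := (toTSZ k p hp a).snd i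

lemma dA_mul (hp : 2 ≤ p) (i : Fin 2) (a b : Amod k p) :
    dA k p hp i (a * b) = augA k p hp a * dA k p hp i b + augA k p hp b * dA k p hp i a := by
  simp [dA, augA, mul_comm]

lemma dA_add (hp : 2 ≤ p) (i : Fin 2) (a b : Amod k p) :
    dA k p hp i (a + b) = dA k p hp i a + dA k p hp i b := by
  simp [dA]

lemma dA_sub (hp : 2 ≤ p) (i : Fin 2) (a b : Amod k p) :
    dA k p hp i (a - b) = dA k p hp i a - dA k p hp i b := by
  simp [dA]

lemma dA_smul (hp : 2 ≤ p) (i : Fin 2) (c : k) (b : Amod k p) :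
    dA k p hp i (c • b) = c * dA k p hp i b := by
  simp [dA]

lemma dA_sum (hp : 2 ≤ p) (i : Fin 2) {ι : Type} (s : Finset ι) (f : ι → Amod k p) :
    dA k p hp i (∑ j ∈ s, f j) = ∑ j ∈ s, dA k p hp i (f j) := by
  simp [dA, TrivSqZeroExt.snd_sum]

lemma augA_mA (hp : 2 ≤ p) (a : Amod k p) (ha : a ∈ mA k p) : augA k p hp a = 0 := by
  obtain ⟨c, d, rfl⟩ := Ideal.mem_span_pair.1 ha
  simp [augA, toTSZ_x, toTSZ_y]

instance finite_Amod [hp : Fact p.Prime] : Module.Finite k (Amod k p) := by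
  have hint : Algebra.IsIntegral k (Amod k p) := by
    constructor
    intro a
    obtain ⟨q, rfl⟩ := Ideal.Quotient.mk_surjective a
    have hp0 : 0 < p := hp.out.pos
    induction q using MvPolynomial.induction_on with
    | C c => exact isIntegral_algebraMap (R := k) (A := Amod k p) (x := c)
    | add f g hf hg => rw [map_add]; exact hf.add hg
    | mul_X f i hf =>
      rw [map_mul]
      refine hf.mul (IsIntegral.of_pow hp0 ?_)
      rw [← map_pow]
      have : (X i : MvPolynomial (Fin 2) k) ^ p ∈ relI k p := by
        apply Ideal.subset_span
        fin_cases i <;> simp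
      rw [Ideal.Quotient.eq_zero_iff_mem.2 this]
      exact isIntegral_zero
  have : Algebra.FiniteType k (Amod k p) :=
    Algebra.FiniteType.of_surjective (Ideal.Quotient.mkₐ k (relI k p))
      (Ideal.Quotient.mkₐ_surjective k _)
  exact Algebra.IsIntegral.finite

lemma coord_mem_mA {r : ℕ} (f : Fin r → Amod k p)
    (hf : f ∈ mA k p • (⊤ : Submodule (Amod k p) (Fin r → Amod k p))) (i : Fin r) :
    f i ∈ mA k p := by
  have := Submodule.smul_le (I := mA k p) (N := (⊤ : Submodule (Amod k p) (Fin r → Amod k p)))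
    (P := Submodule.comap (LinearMap.proj i) (mA k p))
  exact this.2 (fun a ha n _ => by
    simpa using Ideal.mul_mem_right _ _ ha) hf

/-- No pencil of square matrices is everywhere nonsingular. -/
lemma pencil [IsAlgClosed k] {r : ℕ} (hr : 0 < r) (P Q : (Fin r → k) →ₗ[k] (Fin r → k))
    (hP : Function.Surjective P) (h : ∀ l : k, Function.Surjective (Q - l • P)) : False := by
  have hPi : Function.Injective P := LinearMap.injective_iff_surjective.2 hP
  let e := LinearEquiv.ofBijective P ⟨hPi, hP⟩
  have : Nonempty (Fin r) := ⟨⟨0, hr⟩⟩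
  obtain ⟨l, hl⟩ := Module.End.exists_eigenvalue (e.symm.toLinearMap ∘ₗ Q)
  obtain ⟨v, hv⟩ := hl.exists_hasEigenvector
  have h1 : e.symm (Q v) = l • v := hv.apply_eq_smul
  have h2 : Q v = l • P v := by
    have := congrArg e h1
    rw [LinearEquiv.apply_symm_apply, map_smul] at this
    exact this
  have h3 : Function.Injective (Q - l • P) := LinearMap.injective_iff_surjective.2 (h l)
  apply hv.2
  apply h3
  simp [h2]

lemma key (hp : 2 ≤ p) [IsAlgClosed k] (M : Type) [AddCommGroup M] [Module (Amod k p) M]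
    (hE : EIP k p M) (r : ℕ) (hr : 0 < r) (g : (Fin r → Amod k p) →ₗ[Amod k p] M)
    (hg : Function.Surjective g)
    (hK : LinearMap.ker g ≤ mA k p • (⊤ : Submodule (Amod k p) (Fin r → Amod k p)))
    (h : (Fin r → Amod k p) →ₗ[Amod k p] LinearMap.ker g) (hh : Function.Surjective h) :
    False := by
  -- the linear parts of the relations
  let D : Fin 2 → (Fin r → k) →ₗ[k] (Fin r → k) := fun t =>
    Matrix.toLin' (Matrix.of fun i j =>
      dA k p hp t ((h (Pi.single j 1) : Fin r → Amod k p) i))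
  have hD : ∀ t (c : Fin r → Amod k p) i,
      D t (fun j => augA k p hp (c j)) i = dA k p hp t ((h c : Fin r → Amod k p) i) := by
    intro t c i
    have hc : c = ∑ j, c j • (Pi.single j 1 : Fin r → Amod k p) := by
      ext l; simp [Finset.sum_apply, Pi.single_apply]
    conv_rhs => rw [hc]
    rw [map_sum, AddSubmonoidClass.coe_finsetSum, Finset.sum_apply, dA_sum]
    simp only [D, Matrix.toLin'_apply, Matrix.mulVec, dotProduct, Matrix.of_apply]
    refine Finset.sum_congr rfl fun j _ => ?_
    rw [map_smul, Submodule.coe_smul, Pi.smul_apply, smul_eq_mul, dA_mul,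
      augA_mA k p hp _ (coord_mem_mA k p _ (hK (h (Pi.single j 1)).2) i)]
    ring
  have main : ∀ α β : k, (α ≠ 0 ∨ β ≠ 0) → ∀ a b : Fin r → k, ∃ w e : Fin r → k,
      ∀ i, D 0 w i = a i - α * e i ∧ D 1 w i = b i - β * e i := by
    intro α β hαβ a b
    let f : Fin r → Amod k p := fun i => a i • xA k p + b i • yA k p
    have hf : g f ∈ mA k p • (⊤ : Submodule (Amod k p) M) := by
      have hfe : f = xA k p • (fun i => algebraMap k (Amod k p) (a i))
          + yA k p • (fun i => algebraMap k (Amod k p) (b i)) := by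
        ext i
        have hs : ∀ (c : k) (z : Amod k p), c • z = z * algebraMap k (Amod k p) c :=
          fun c z => by rw [mul_comm]; exact Algebra.smul_def c z
        simp only [f, Pi.add_apply, Pi.smul_apply, smul_eq_mul]
        rw [hs, hs]
      rw [hfe, map_add, map_smul, map_smul]
      refine add_mem (Submodule.smul_mem_smul (Ideal.subset_span ?_) trivial)
        (Submodule.smul_mem_smul (Ideal.subset_span ?_) trivial) <;> simp
    rw [← hE (α • xA k p + β • yA k p) ⟨α, β, hαβ, rfl⟩] at hf
    obtain ⟨m, hm⟩ := hf
    obtain ⟨c, rfl⟩ := hg m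
    have hk : f - (α • xA k p + β • yA k p) • c ∈ LinearMap.ker g := by
      rw [LinearMap.mem_ker, map_sub, map_smul, sub_eq_zero]
      exact hm.symm
    obtain ⟨w, hw⟩ := hh ⟨_, hk⟩
    have ax : augA k p hp (xA k p) = 0 := augA_mA k p hp _ (Ideal.subset_span (by simp))
    have ay : augA k p hp (yA k p) = 0 := augA_mA k p hp _ (Ideal.subset_span (by simp))
    have au : augA k p hp (α • xA k p + β • yA k p) = 0 := by
      simp only [augA] at ax ay
      simp [augA, ax, ay]
    refine ⟨fun j => augA k p hp (w j), fun j => augA k p hp (c j), fun i => ?_⟩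
    rw [hD, hD, hw]
    have x0 : dA k p hp 0 (xA k p) = 1 := by simp [dA, toTSZ_x]
    have x1 : dA k p hp 1 (xA k p) = 0 := by simp [dA, toTSZ_x]
    have y0 : dA k p hp 0 (yA k p) = 0 := by simp [dA, toTSZ_y]
    have y1 : dA k p hp 1 (yA k p) = 1 := by simp [dA, toTSZ_y]
    simp only [Pi.sub_apply, Pi.smul_apply, smul_eq_mul, f, dA_sub, dA_add, dA_smul, dA_mul,
      au, x0, x1, y0, y1]
    constructor <;> ring
  refine pencil k hr (D 0) (D 1) ?_ ?_
  · intro v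
    obtain ⟨w, e, hw⟩ := main 0 1 (Or.inr one_ne_zero) v 0
    exact ⟨w, funext fun i => by rw [(hw i).1]; ring⟩
  · intro l v
    obtain ⟨w, e, hw⟩ := main 1 l (Or.inl one_ne_zero) 0 v
    refine ⟨w, funext fun i => ?_⟩
    simp only [LinearMap.sub_apply, LinearMap.smul_apply, Pi.sub_apply, Pi.smul_apply,
      smul_eq_mul, (hw i).1, (hw i).2, Pi.zero_apply]
    ring

/-- if `M ≠ 0` has the equal images property and `N` is a minimal second
syzygy of `M` having the same Jordan type as `M` (same dimension and the same ranks of all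
powers of all point operators), then `N` does not have the equal images property. -/
theorem minSecondSyz_sameJordanType_not_EIP
    [IsAlgClosed k] [Fact p.Prime] [CharP k p]
    (M : Type) [AddCommGroup M] [Module (Amod k p) M]
    [Module k M] [IsScalarTower k (Amod k p) M] [FiniteDimensional k M]
    (N : Type) [AddCommGroup N] [Module (Amod k p) N]
    [Module k N] [IsScalarTower k (Amod k p) N] [FiniteDimensional k N]
    (hM : Nontrivial M) (hE : EIP k p M)
    (hN : IsMinSyz k p 2 (ModuleCat.of (Amod k p) N) (ModuleCat.of (Amod k p) M))
    (hdim : finrank k N = finrank k M)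
    (hrk : ∀ u : Amod k p, IsPointOp k p u → ∀ j : ℕ, 1 ≤ j →
      finrank k (↥(LinearMap.range ((LinearMap.lsmul (Amod k p) N u) ^ j)))
        = finrank k (↥(LinearMap.range ((LinearMap.lsmul (Amod k p) M u) ^ j)))) :
    ¬ EIP k p N := by
  intro _
  have hp : 2 ≤ p := (Fact.out : p.Prime).two_le
  obtain ⟨r, g, hg, hgK, s, h, hh, -, ⟨e⟩⟩ := hN
  change (Fin r → Amod k p) →ₗ[Amod k p] M at g
  change (Fin s → Amod k p) →ₗ[Amod k p] LinearMap.ker g at h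
  change N ≃ₗ[Amod k p] LinearMap.ker h at e
  have : Nontrivial (Amod k p) := (toTSZ k p hp).toRingHom.domain_nontrivial
  have hA : 0 < finrank k (Amod k p) := finrank_pos
  have e1 := LinearMap.finrank_range_add_finrank_ker (g.restrictScalars k)
  have e2 := LinearMap.finrank_range_add_finrank_ker (h.restrictScalars k)
  have e3 : finrank k N = finrank k (LinearMap.ker h) :=
    LinearEquiv.finrank_eq (e.restrictScalars k)
  rw [LinearMap.range_eq_top.2 (show Function.Surjective (g.restrictScalars k) from hg),
    finrank_top, Module.finrank_pi_fintype] at e1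
  rw [LinearMap.range_eq_top.2 (show Function.Surjective (h.restrictScalars k) from hh),
    finrank_top, Module.finrank_pi_fintype] at e2
  simp only [Finset.sum_const, Finset.card_univ, Fintype.card_fin, smul_eq_mul] at e1 e2
  have e4 : finrank k (LinearMap.ker (g.restrictScalars k)) = finrank k (LinearMap.ker g) := rfl
  have e5 : finrank k (LinearMap.ker (h.restrictScalars k)) = finrank k (LinearMap.ker h) := rfl
  have hsr : s * finrank k (Amod k p) = r * finrank k (Amod k p) := by omega
  obtain rfl : s = r := Nat.eq_of_mul_eq_mul_right hA hsr
  have hr : 0 < s := by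
    rcases Nat.eq_zero_or_pos s with rfl | h0
    · exfalso
      obtain ⟨m, hm⟩ := exists_ne (0 : M)
      obtain ⟨c, rfl⟩ := hg m
      exact hm (by rw [Subsingleton.elim c 0, map_zero])
    · exact h0
  exact key k p hp M hE s hr g hg hgK h hh

end
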